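/- arXiv:1812.10123 — 2 statements merged into one kernel-verified Lean document; each statement's English description precedes it below -/
import Mathlib

section
/- Let Δ ⊂ ℝ^d be a lattice simplex of dimension d with vertices v_1, …, v_{d+1} ∈ ℤ^d, let k ≥ 3 be an integer, and for each integer i set h_i = #{α ∈ Λ_Δ : ht(α) = i}. Assume h_{k+1} = h_{k+2} = ⋯ = h_{2k} = 0. Then there exist e ≥ 1 and a lattice simplex Q ⊂ ℝ^e of dimension e such that #(nQ ∩ ℤ^e) = Σ_{i=0}^{k} h_i · C(n+e−i, e) for every integer n ≥ 1; in particular (h_0, h_1, …, h_k) satisfies the degree k condition (it is the coefficient sequence of the h*-polynomial of a lattice polytope of degree at most k). -/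
open scoped Pointwise

/-- The coercion of an integer point to a real point. -/
def toReal {d : ℕ} (x : Fin d → ℤ) : Fin d → ℝ := fun i => (x i : ℝ)

/-- The number of lattice points in the `n`-th dilation of `P ⊆ ℝ^d`. -/
noncomputable def latticeCount {d : ℕ} (P : Set (Fin d → ℝ)) (n : ℕ) : ℕ :=
  Set.ncard {x : Fin d → ℤ | toReal x ∈ (n : ℝ) • P}

/-- The finite abelian group `Λ_Δ` attached to a lattice simplex with vertices `v`. -/
def Lambda {d : ℕ} (v : Fin (d + 1) → Fin d → ℤ) : Set (Fin (d + 1) → ℝ) :=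
  {r | (∀ j, 0 ≤ r j ∧ r j < 1) ∧
    (∀ i : Fin d, ∃ z : ℤ, ∑ j, r j * (v j i : ℝ) = (z : ℝ)) ∧
    (∃ z : ℤ, ∑ j, r j = (z : ℝ))}

/-- The height `ht(α) = ∑ᵢ αᵢ`. -/
def ht {m : ℕ} (α : Fin m → ℝ) : ℝ := ∑ i, α i

/-- The support `supp(α) = {i : αᵢ > 0}`. -/
def suppOf {m : ℕ} (α : Fin m → ℝ) : Set (Fin m) := {i | 0 < α i}

/-- Addition on `Λ_Δ`: coordinatewise fractional part of the sum. -/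
noncomputable def fadd {m : ℕ} (α β : Fin m → ℝ) : Fin m → ℝ := fun i => Int.fract (α i + β i)

/-- Negation on `Λ_Δ`: coordinatewise fractional part of `1 - αᵢ`. -/
noncomputable def fneg {m : ℕ} (α : Fin m → ℝ) : Fin m → ℝ := fun i => Int.fract (1 - α i)

/-- `P ⊆ ℝ^d` is a lattice polytope of dimension `d`: the convex hull of a finite
set of lattice points whose affine span is all of `ℝ^d`. -/
def IsFullDimLatticePolytope {d : ℕ} (P : Set (Fin d → ℝ)) : Prop :=
  ∃ V : Finset (Fin d → ℤ),
    P = convexHull ℝ (toReal '' (V : Set (Fin d → ℤ))) ∧ affineSpan ℝ P = ⊤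

/-- The group of real relations `r` whose total weight and whose weighted vertex sum are integral. -/
def integralRelations {d : ℕ} (v : Fin (d + 1) → Fin d → ℤ) : AddSubgroup (Fin (d + 1) → ℝ) where
  carrier := {r | (∀ i : Fin d, ∃ z : ℤ, ∑ j, r j * (v j i : ℝ) = (z : ℝ)) ∧
    (∃ z : ℤ, ∑ j, r j = (z : ℝ))}
  zero_mem' := ⟨fun _ => ⟨0, by simp⟩, 0, by simp⟩
  add_mem' := by
    rintro r s ⟨hr, z, hz⟩ ⟨hs, y, hy⟩
    refine ⟨fun i => ?_, z + y, by simp [Finset.sum_add_distrib, hz, hy]⟩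
    obtain ⟨a, ha⟩ := hr i
    obtain ⟨b, hb⟩ := hs i
    exact ⟨a + b, by simp [add_mul, Finset.sum_add_distrib, ha, hb]⟩
  neg_mem' := by
    rintro r ⟨hr, z, hz⟩
    refine ⟨fun i => ?_, -z, by simp [hz]⟩
    obtain ⟨a, ha⟩ := hr i
    exact ⟨-a, by simp [ha]⟩

lemma intCast_mem_integralRelations {d : ℕ} (v : Fin (d + 1) → Fin d → ℤ) (m : Fin (d + 1) → ℤ) :
    (fun j => (m j : ℝ)) ∈ integralRelations v :=
  ⟨fun i => ⟨∑ j, m j * v j i, by push_cast; rfl⟩, ∑ j, m j, by push_cast; rfl⟩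

/-- Coordinatewise fractional part. -/
noncomputable def fractVec {m : ℕ} (r : Fin m → ℝ) : Fin m → ℝ := fun j => Int.fract (r j)

lemma fractVec_add_floor {m : ℕ} (r : Fin m → ℝ) :
    fractVec r + (fun j => ((⌊r j⌋ : ℤ) : ℝ)) = r := by
  ext j; simp [fractVec]

lemma fractVec_add_intCast {m : ℕ} (r : Fin m → ℝ) (z : Fin m → ℤ) :
    fractVec (r + fun j => (z j : ℝ)) = fractVec r := by
  ext j; simp [fractVec]

lemma fractVec_eq_self {m : ℕ} {r : Fin m → ℝ} (hr : ∀ j, 0 ≤ r j ∧ r j < 1) :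
    fractVec r = r := by
  ext j; exact Int.fract_eq_self.2 (hr j)

lemma mem_Lambda_iff {d : ℕ} {v : Fin (d + 1) → Fin d → ℤ} {r : Fin (d + 1) → ℝ} :
    r ∈ Lambda v ↔ (∀ j, 0 ≤ r j ∧ r j < 1) ∧ r ∈ integralRelations v := Iff.rfl

lemma fractVec_mem_Lambda_iff {d : ℕ} {v : Fin (d + 1) → Fin d → ℤ} {r : Fin (d + 1) → ℝ} :
    fractVec r ∈ Lambda v ↔ r ∈ integralRelations v := by
  rw [mem_Lambda_iff, and_iff_right fun j => ⟨Int.fract_nonneg _, Int.fract_lt_one _⟩]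
  conv_rhs => rw [← fractVec_add_floor r]
  rw [AddSubgroup.add_mem_cancel_right _ (intCast_mem_integralRelations v _)]

lemma exists_ht_eq_natCast {d : ℕ} {v : Fin (d + 1) → Fin d → ℤ} {α : Fin (d + 1) → ℝ}
    (hα : α ∈ Lambda v) : ∃ i : ℕ, ht α = i := by
  obtain ⟨h0, -, z, hz⟩ := hα
  have : (0 : ℝ) ≤ z := hz ▸ Finset.sum_nonneg fun j _ => (h0 j).1
  lift z to ℕ using by exact_mod_cast this
  exact ⟨z, by simpa [ht] using hz⟩

lemma affineIndependent_toReal_iff {d : ℕ} {v : Fin (d + 1) → Fin d → ℤ} :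
    AffineIndependent ℝ (fun j => toReal (v j)) ↔
      ∀ c : Fin (d + 1) → ℝ, ∑ j, c j = 0 → (∀ i, ∑ j, c j * (v j i : ℝ) = 0) → c = 0 := by
  rw [affineIndependent_iff_of_fintype]
  refine forall_congr' fun c => forall_congr' fun hc => ?_
  rw [Finset.univ.weightedVSub_eq_linear_combination hc]
  simp [funext_iff, toReal]

lemma relation_ext {d : ℕ} {v : Fin (d + 1) → Fin d → ℤ}
    (hv : AffineIndependent ℝ (fun j => toReal (v j))) {r s : Fin (d + 1) → ℝ}
    (hsum : ∑ j, r j = ∑ j, s j)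
    (hvec : ∀ i, ∑ j, r j * (v j i : ℝ) = ∑ j, s j * (v j i : ℝ)) : r = s := by
  refine sub_eq_zero.1 (affineIndependent_toReal_iff.1 hv (r - s) ?_ fun i => ?_)
  · simp [hsum]
  · simp [sub_mul, hvec]

lemma finite_Lambda {d : ℕ} {v : Fin (d + 1) → Fin d → ℤ}
    (hv : AffineIndependent ℝ (fun j => toReal (v j))) : (Lambda v).Finite := by
  classical
  let f : (Fin (d + 1) → ℝ) → (Fin d → ℤ) × ℤ :=
    fun r => (fun i => ⌊∑ j, r j * (v j i : ℝ)⌋, ⌊∑ j, r j⌋)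
  have hinj : Set.InjOn f (Lambda v) := by
    rintro r ⟨-, hr, z, hz⟩ s ⟨-, hs, y, hy⟩ hrs
    simp only [f, Prod.mk.injEq, funext_iff] at hrs
    refine relation_ext hv ?_ fun i => ?_
    · have := hrs.2
      rw [hz, hy] at this ⊢
      simpa using this
    · have := hrs.1 i
      obtain ⟨a, ha⟩ := hr i
      obtain ⟨b, hb⟩ := hs i
      rw [ha, hb] at this ⊢
      simpa using this
  refine Set.Finite.of_finite_image (Set.Finite.subset (Set.finite_Icc
    ((fun i => -∑ j, |v j i|, 0) : (Fin d → ℤ) × ℤ)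
    (fun i => ∑ j, |v j i|, (d + 1 : ℤ))) ?_) hinj
  rintro _ ⟨r, ⟨h0, hr, z, hz⟩, rfl⟩
  have key : ∀ i, |∑ j, r j * (v j i : ℝ)| ≤ ((∑ j, |v j i| : ℤ) : ℝ) := fun i => by
    push_cast
    refine (Finset.abs_sum_le_sum_abs _ _).trans (Finset.sum_le_sum fun j _ => ?_)
    rw [abs_mul, abs_of_nonneg (h0 j).1]
    exact mul_le_of_le_one_left (abs_nonneg _) (h0 j).2.le
  refine ⟨⟨fun i => ?_, ?_⟩, fun i => ?_, ?_⟩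
  · refine Int.le_floor.2 ?_
    have := (abs_le.1 (key i)).1
    push_cast at this ⊢
    exact this
  · exact Int.floor_nonneg.2 (Finset.sum_nonneg fun j _ => (h0 j).1)
  · exact Int.cast_le.1 ((Int.floor_le _).trans (abs_le.1 (key i)).2)
  · refine Int.cast_le (R := ℝ).1 ((Int.floor_le _).trans ?_)
    refine (Finset.sum_le_sum fun j _ => (h0 j).2.le).trans ?_
    simp

lemma toReal_mem_smul_convexHull_iff {m e : ℕ} {w : Fin m → Fin e → ℤ} {n : ℕ} (hn : 1 ≤ n)
    {x : Fin e → ℤ} :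
    toReal x ∈ (n : ℝ) • convexHull ℝ (Set.range fun j => toReal (w j)) ↔
      ∃ r : Fin m → ℝ, (∀ j, 0 ≤ r j) ∧ ∑ j, r j = n ∧ ∀ i, ∑ j, r j * (w j i : ℝ) = x i := by
  have hn0 : (0 : ℝ) < n := by exact_mod_cast hn
  have hull : convexHull ℝ (Set.range fun j => toReal (w j)) =
      Fintype.linearCombination ℝ (fun j => toReal (w j)) '' stdSimplex ℝ (Fin m) := by
    rw [← convexHull_basis_eq_stdSimplex, LinearMap.image_convexHull, ← Set.range_comp]
    congr 2
    funext j
    simp [Fintype.linearCombination_apply, ite_smul]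
  rw [hull, Set.mem_smul_set]
  constructor
  · rintro ⟨_, ⟨r, ⟨h0, h1⟩, rfl⟩, hx⟩
    refine ⟨fun j => n * r j, fun j => mul_nonneg hn0.le (h0 j), by
      rw [← Finset.mul_sum, h1, mul_one], fun i => ?_⟩
    have := congrFun hx i
    simpa [Fintype.linearCombination_apply, toReal, Finset.mul_sum, mul_assoc] using this
  · rintro ⟨r, h0, h1, hx⟩
    refine ⟨_, ⟨fun j => r j / n, ⟨fun j => div_nonneg (h0 j) hn0.le, by
      rw [← Finset.sum_div, h1, div_self hn0.ne']⟩, rfl⟩, ?_⟩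
    ext i
    simp only [Fintype.linearCombination_apply, Pi.smul_apply, Finset.sum_apply, smul_eq_mul,
      toReal, Finset.mul_sum, ← hx i]
    exact Finset.sum_congr rfl fun j _ => by field_simp

lemma latticeCount_simplex {e : ℕ} {w : Fin (e + 1) → Fin e → ℤ}
    (hw : AffineIndependent ℝ (fun j => toReal (w j))) {n : ℕ} (hn : 1 ≤ n) :
    latticeCount (convexHull ℝ (Set.range fun j => toReal (w j))) n =
      Set.ncard {r : Fin (e + 1) → ℝ | (∀ j, 0 ≤ r j) ∧ ∑ j, r j = n ∧
        r ∈ integralRelations w} := by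
  symm
  refine Set.BijOn.ncard_eq (f := fun r i => ⌊∑ j, r j * (w j i : ℝ)⌋) ⟨?_, ?_, ?_⟩
  · rintro r ⟨h0, h1, hr, -⟩
    refine (toReal_mem_smul_convexHull_iff hn).2 ⟨r, h0, h1, fun i => ?_⟩
    obtain ⟨z, hz⟩ := hr i
    simp [hz]
  · rintro r ⟨-, h1, hr, -⟩ s ⟨-, h1', hs, -⟩ hrs
    refine relation_ext hw (h1.trans h1'.symm) fun i => ?_
    have := congrFun hrs i
    obtain ⟨a, ha⟩ := hr i
    obtain ⟨b, hb⟩ := hs i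
    simp only [ha, hb, Int.floor_intCast] at this ⊢
    rw [this]
  · intro x hx
    obtain ⟨r, h0, h1, hr⟩ := (toReal_mem_smul_convexHull_iff hn).1 hx
    exact ⟨r, ⟨h0, h1, fun i => ⟨x i, hr i⟩, n, by simpa using h1⟩, by ext i; simp [hr i]⟩

lemma ncard_nonneg_fractVec_mem {e : ℕ} (he : 1 ≤ e) (H : Finset (Fin (e + 1) → ℝ))
    (hH : ∀ α ∈ H, ∀ j, 0 ≤ α j ∧ α j < 1) (c : (Fin (e + 1) → ℝ) → ℕ)
    (hc : ∀ α ∈ H, ht α = c α) (n : ℕ) :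
    Set.ncard {r : Fin (e + 1) → ℝ | (∀ j, 0 ≤ r j) ∧ ∑ j, r j = n ∧ fractVec r ∈ H} =
      ∑ α ∈ H, (n + e - c α).choose e := by
  classical
  let T : Finset (Σ _ : Fin (e + 1) → ℝ, Fin (e + 1) →₀ ℕ) := H.sigma fun α =>
    if c α ≤ n then Finset.finsuppAntidiag Finset.univ (n - c α) else ∅
  have hT : T.card = ∑ α ∈ H, (n + e - c α).choose e := by
    rw [Finset.card_sigma]
    refine Finset.sum_congr rfl fun α _ => ?_
    split_ifs with h
    · rw [Finset.card_finsuppAntidiag_nat_eq_choose, Finset.card_univ, Fintype.card_fin,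
        ← Nat.choose_symm (by omega)]
      congr 1 <;> omega
    · rw [Finset.card_empty, Nat.choose_eq_zero_of_lt (by omega)]
  rw [← hT, ← Set.ncard_coe_finset]
  symm
  have hfr : ∀ α ∈ H, ∀ m : Fin (e + 1) →₀ ℕ, fractVec (fun j => α j + m j) = α := by
    intro α hα m
    have : fractVec (fun j => α j + ((m j : ℤ) : ℝ)) = fractVec α :=
      fractVec_add_intCast α fun j => (m j : ℤ)
    rw [fractVec_eq_self (hH α hα)] at this
    simpa using this
  have hmem : ∀ p, p ∈ T ↔ p.1 ∈ H ∧ (∑ j, p.2 j) + c p.1 = n := by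
    rintro ⟨α, m⟩
    simp only [T, Finset.mem_sigma]
    refine and_congr_right fun _ => ?_
    split_ifs with h
    · simp only [Finset.mem_finsuppAntidiag, Finset.subset_univ, and_true]
      change (∑ j, m j) = n - c α ↔ _
      omega
    · simp only [Finset.notMem_empty, false_iff]
      omega
  refine Set.BijOn.ncard_eq (f := fun p j => p.1 j + (p.2 j : ℝ)) ⟨?_, ?_, ?_⟩
  · rintro ⟨α, m⟩ hp
    obtain ⟨hα, hm⟩ := (hmem _).1 hp
    refine ⟨fun j => add_nonneg (hH α hα j).1 (Nat.cast_nonneg _), ?_, ?_⟩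
    · have := hc α hα
      simp only [ht] at this
      simp only [Finset.sum_add_distrib, this, ← hm]
      push_cast
      ring
    · simpa only [hfr α hα m] using hα
  · rintro ⟨α, m⟩ hp ⟨β, m'⟩ hp' heq
    obtain ⟨hα, -⟩ := (hmem _).1 hp
    obtain ⟨hβ, -⟩ := (hmem _).1 hp'
    simp only at heq hα hβ
    obtain rfl : α = β := by rw [← hfr α hα m, heq, hfr β hβ m']
    obtain rfl : m = m' := by
      ext j
      simpa using congrFun heq j
    rfl
  · rintro r ⟨h0, h1, hr⟩
    have hfl : ∀ j, ((⌊r j⌋₊ : ℕ) : ℝ) = ((⌊r j⌋ : ℤ) : ℝ) := fun j => by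
      rw [natCast_floor_eq_intCast_floor (h0 j)]
    have hdec : (fun j => fractVec r j + ((⌊r j⌋₊ : ℕ) : ℝ)) = r := by
      ext j; simp [hfl, fractVec]
    refine ⟨⟨fractVec r, Finsupp.equivFunOnFinite.symm fun j => ⌊r j⌋₊⟩, (hmem _).2 ⟨hr, ?_⟩, ?_⟩
    · have := hc _ hr
      rw [← hdec, Finset.sum_add_distrib] at h1
      rw [ht] at this
      rw [this] at h1
      rw [add_comm]
      exact_mod_cast h1
    · simpa using hdec

/-- The Ehrhart function of a lattice simplex in terms of `Λ`. -/
lemma latticeCount_simplex_eq_sum {e : ℕ} (he : 1 ≤ e) {w : Fin (e + 1) → Fin e → ℤ}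
    (hw : AffineIndependent ℝ (fun j => toReal (w j))) {k : ℕ} (hk : ∀ α ∈ Lambda w, ht α ≤ k)
    {n : ℕ} (hn : 1 ≤ n) :
    latticeCount (convexHull ℝ (Set.range fun j => toReal (w j))) n =
      ∑ i ∈ Finset.range (k + 1),
        Set.ncard {α | α ∈ Lambda w ∧ ht α = (i : ℝ)} * (n + e - i).choose e := by
  classical
  have hfin := finite_Lambda hw
  have hc : ∀ α ∈ hfin.toFinset, ht α = (⌊ht α⌋₊ : ℕ) := fun α hα => by
    obtain ⟨i, hi⟩ := exists_ht_eq_natCast (hfin.mem_toFinset.1 hα)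
    simp [hi]
  have := ncard_nonneg_fractVec_mem he hfin.toFinset
    (fun α hα => (hfin.mem_toFinset.1 hα).1) (fun α => ⌊ht α⌋₊) hc n
  simp only [Set.Finite.mem_toFinset, fractVec_mem_Lambda_iff] at this
  rw [latticeCount_simplex hw hn, this]
  rw [← Finset.sum_fiberwise_of_maps_to (g := fun α => ⌊ht α⌋₊) (t := Finset.range (k + 1))]
  · refine Finset.sum_congr rfl fun i _ => ?_
    rw [Finset.sum_congr rfl (g := fun _ => (n + e - i).choose e) (fun α hα => by
      rw [(Finset.mem_filter.1 hα).2]), Finset.sum_const, smul_eq_mul, ← Set.ncard_coe_finset]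
    congr 2
    ext α
    simp only [Finset.coe_filter, Set.Finite.mem_toFinset]
    refine and_congr_right fun hα => ?_
    have := hc α (hfin.mem_toFinset.2 hα)
    exact ⟨fun h => h ▸ this, fun h => by simp [h]⟩
  · intro α hα
    have h1 := hc α hα
    have h2 := hk α (hfin.mem_toFinset.1 hα)
    rw [h1] at h2
    exact Finset.mem_range.2 (Nat.lt_succ_of_le (by exact_mod_cast h2))

lemma linearIndependent_toReal_sub {d : ℕ} {v : Fin (d + 1) → Fin d → ℤ}
    (hv : AffineIndependent ℝ (fun j => toReal (v j))) :
    LinearIndependent ℝ fun j : Fin d => toReal (v j.succ - v 0) := by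
  have h := (affineIndependent_iff_linearIndependent_vsub ℝ _ (0 : Fin (d + 1))).1 hv
  have h' := h.comp (fun j : Fin d => ⟨j.succ, Fin.succ_ne_zero j⟩) fun i j hij => by
    simpa using hij
  have heq : (fun j : Fin d => toReal (v j.succ - v 0)) =
      fun j : Fin d => toReal (v j.succ) - toReal (v 0) := by
    ext j i
    simp [toReal]
  rw [heq]
  exact h'

/-- Coercion of integer vectors to real vectors as an additive map. -/
def toRealHom (d : ℕ) : (Fin d → ℤ) →ₗ[ℤ] (Fin d → ℝ) :=
  (AddMonoidHom.mk' toReal fun x y => by ext i; simp [toReal]).toIntLinearMap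

/-- A group of relations between the vertices of a lattice simplex that contains all integral
relations is the group of relations of another lattice simplex. -/
lemma exists_simplex_integralRelations_eq {d : ℕ} {v : Fin (d + 1) → Fin d → ℤ}
    (hv : AffineIndependent ℝ (fun j => toReal (v j))) (L : AddSubgroup (Fin (d + 1) → ℝ))
    (hL : L ≤ integralRelations v) (hint : ∀ m : Fin (d + 1) → ℤ, (fun j => (m j : ℝ)) ∈ L) :
    ∃ w : Fin (d + 1) → Fin d → ℤ,
      AffineIndependent ℝ (fun j => toReal (w j)) ∧ integralRelations w = L := by
  classical
  let N : AddSubgroup (Fin d → ℤ) :=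
    { carrier := {x | ∃ r ∈ L, ∑ j, r j = 0 ∧ ∀ i, ∑ j, r j * (v j i : ℝ) = x i}
      zero_mem' := ⟨0, L.zero_mem, by simp, by simp⟩
      add_mem' := by
        rintro x y ⟨r, hr, hr0, hrx⟩ ⟨s, hs, hs0, hsy⟩
        exact ⟨r + s, L.add_mem hr hs, by simp [Finset.sum_add_distrib, hr0, hs0],
          fun i => by simp [add_mul, Finset.sum_add_distrib, hrx, hsy]⟩
      neg_mem' := by
        rintro x ⟨r, hr, hr0, hrx⟩
        exact ⟨-r, L.neg_mem hr, by simp [hr0], fun i => by simp [hrx]⟩ }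
  have mem_N : ∀ x, x ∈ N ↔ ∃ r ∈ L, ∑ j, r j = 0 ∧ ∀ i, ∑ j, r j * (v j i : ℝ) = x i :=
    fun _ => Iff.rfl
  let M : Submodule ℤ (Fin d → ℤ) := AddSubgroup.toIntSubmodule N
  have hu : ∀ j, v j - v 0 ∈ M := fun j => by
    refine (mem_N _).2 ⟨fun l => ((Pi.single j 1 - Pi.single 0 1 : Fin (d + 1) → ℤ) l : ℝ),
      hint _, ?_, fun i => ?_⟩
    · rw [← Int.cast_sum]
      simp
    · simp only [Pi.sub_apply, ← Int.cast_mul, ← Int.cast_sum]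
      simp [sub_mul, Pi.single_apply]
  have hli := linearIndependent_toReal_sub hv
  have hrank : Module.finrank ℤ M = d := by
    refine le_antisymm ((Submodule.finrank_le M).trans (by simp)) ?_
    have h1 : LinearIndependent ℤ fun j : Fin d => (⟨v j.succ - v 0, hu _⟩ : M) := by
      refine LinearIndependent.of_comp ((toRealHom d).comp M.subtype) ?_
      exact hli.restrict_scalars fun a b hab => by simpa using hab
    simpa using h1.fintype_card_le_finrank
  let b : Module.Basis (Fin d) ℤ M := Module.finBasisOfFinrankEq ℤ M hrank
  let w : Fin (d + 1) → Fin d → ℤ := fun j i => b.repr ⟨v j - v 0, hu j⟩ i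
  have hexp : ∀ x : M, ∀ l, (x : Fin d → ℤ) l = ∑ i, b.repr x i * (b i : Fin d → ℤ) l :=
    fun x l => by
      conv_lhs => rw [← b.sum_repr x]
      simp only [Submodule.coe_sum, Submodule.coe_smul, Finset.sum_apply, Pi.smul_apply,
        smul_eq_mul]
  have hw : ∀ (r : Fin (d + 1) → ℝ) l, ∑ j, r j * (v j l : ℝ) - (∑ j, r j) * v 0 l =
      ∑ i, (∑ j, r j * (w j i : ℝ)) * ((b i : Fin d → ℤ) l : ℝ) := fun r l => by
    have h1 : ∀ j, ((v j l : ℝ) - v 0 l) = ∑ i, (w j i : ℝ) * ((b i : Fin d → ℤ) l : ℝ) :=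
      fun j => by exact_mod_cast hexp ⟨v j - v 0, hu j⟩ l
    rw [Finset.sum_mul, ← Finset.sum_sub_distrib]
    simp only [← mul_sub, h1, Finset.mul_sum, Finset.sum_mul]
    rw [Finset.sum_comm]
    simp only [mul_assoc]
  have hb : LinearIndependent ℝ fun i => toReal (b i : Fin d → ℤ) := by
    rw [linearIndependent_iff_card_le_finrank_span, ← finrank_span_eq_card hli, Set.finrank]
    refine Submodule.finrank_mono (Submodule.span_le.2 ?_)
    rintro _ ⟨j, rfl⟩
    have : toReal (v j.succ - v 0) = ∑ i, (w j.succ i : ℝ) • toReal (b i : Fin d → ℤ) := by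
      ext l
      have := hexp ⟨v j.succ - v 0, hu j.succ⟩ l
      simp only [toReal, Finset.sum_apply, Pi.smul_apply, smul_eq_mul]
      exact_mod_cast this
    simp only [SetLike.mem_coe, this]
    exact Submodule.sum_mem _ fun i _ => Submodule.smul_mem _ _ (Submodule.subset_span ⟨i, rfl⟩)
  have hshift : ∀ z : ℤ, (fun j => ((Pi.single 0 z : Fin (d + 1) → ℤ) j : ℝ)) ∈ L :=
    fun z => hint _
  have hshift_sum : ∀ z : ℤ, ∑ j, ((Pi.single 0 z : Fin (d + 1) → ℤ) j : ℝ) = z := fun z => by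
    rw [← Int.cast_sum]
    simp
  have hshift_vec : ∀ (z : ℤ) i,
      ∑ j, ((Pi.single 0 z : Fin (d + 1) → ℤ) j : ℝ) * (v j i : ℝ) = z * v 0 i := fun z i => by
    simp only [← Int.cast_mul, ← Int.cast_sum]
    simp [Pi.single_apply]
  refine ⟨w, affineIndependent_toReal_iff.2 fun c hc hcw => ?_, ?_⟩
  · refine affineIndependent_toReal_iff.1 hv c hc fun l => ?_
    simpa [hc, hcw] using hw c l
  ext r
  constructor
  · rintro ⟨hr, z, hz⟩
    choose y hy using hr
    obtain ⟨s, hs, hs0, hsx⟩ := (mem_N _).1 (∑ i, y i • b i : M).2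
    have : r = s + fun j => ((Pi.single 0 z : Fin (d + 1) → ℤ) j : ℝ) := by
      refine relation_ext hv ?_ fun l => ?_
      · simp only [Pi.add_apply, Finset.sum_add_distrib, hs0, hshift_sum, hz, zero_add]
      · simp only [Pi.add_apply, add_mul, Finset.sum_add_distrib, hsx, hshift_vec]
        rw [← sub_eq_iff_eq_add, ← hz, hw]
        simp [hy]
    rw [this]
    exact L.add_mem hs (hshift z)
  · intro hrL
    obtain ⟨-, z, hz⟩ := hL hrL
    refine ⟨?_, z, hz⟩
    have hs := L.sub_mem hrL (hshift z)
    obtain ⟨hsv, -⟩ := hL hs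
    choose x hx using hsv
    have hxN : x ∈ M := (mem_N _).2 ⟨_, hs, by
      simp only [Pi.sub_apply, Finset.sum_sub_distrib, hshift_sum, hz, sub_self], hx⟩
    have hcomb : ∑ i, (∑ j, r j * (w j i : ℝ)) • toReal (b i : Fin d → ℤ) =
        ∑ i, (b.repr ⟨x, hxN⟩ i : ℝ) • toReal (b i : Fin d → ℤ) := by
      ext l
      have h1 := hexp ⟨x, hxN⟩ l
      have h2 := hx l
      simp only [Pi.sub_apply, sub_mul, Finset.sum_sub_distrib, hshift_vec] at h2
      simp only [Finset.sum_apply, Pi.smul_apply, smul_eq_mul, toReal, ← hw, hz, h2]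
      exact_mod_cast h1
    exact fun i => ⟨_, Fintype.linearIndependent_iffₛ.1 hb _ _ hcomb i⟩

/-- If no element of `Λ` has height in `(k, 2k]`, the relations whose fractional part has height
at most `k` form a group. -/
lemma exists_addSubgroup_ht_le {d : ℕ} {v : Fin (d + 1) → Fin d → ℤ}
    (hv : AffineIndependent ℝ (fun j => toReal (v j))) {k : ℕ}
    (hgap : ∀ α ∈ Lambda v, ht α ≤ 2 * k → ht α ≤ k) :
    ∃ L : AddSubgroup (Fin (d + 1) → ℝ),
      ∀ r, r ∈ L ↔ r ∈ integralRelations v ∧ ht (fractVec r) ≤ k := by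
  let S : AddSubmonoid (Fin (d + 1) → ℝ) :=
    { carrier := {r | r ∈ integralRelations v ∧ ht (fractVec r) ≤ k}
      zero_mem' := ⟨zero_mem _, by simp [ht, fractVec]⟩
      add_mem' := by
        rintro r s ⟨hr, hrk⟩ ⟨hs, hsk⟩
        have hrs := add_mem hr hs
        refine ⟨hrs, hgap _ (fractVec_mem_Lambda_iff.2 hrs) ?_⟩
        have : ht (fractVec (r + s)) ≤ ht (fractVec r) + ht (fractVec s) := by
          rw [ht, ht, ht, ← Finset.sum_add_distrib]
          exact Finset.sum_le_sum fun j _ => Int.fract_add_le _ _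
        linarith }
  have mem_S : ∀ r, r ∈ S ↔ r ∈ integralRelations v ∧ ht (fractVec r) ≤ k := fun _ => Iff.rfl
  refine ⟨{ S with neg_mem' := ?_ }, mem_S⟩
  intro r hr
  change r ∈ S at hr
  change -r ∈ S
  obtain ⟨a, -, b, -, hab, heq⟩ := Set.infinite_univ.exists_lt_map_eq_of_mapsTo
    (f := fun a : ℕ => fractVec (a • r)) (t := Lambda v)
    (fun a _ => fractVec_mem_Lambda_iff.2 (nsmul_mem ((mem_S r).1 hr).1 a)) (finite_Lambda hv)
  have hz : -r = (b - a - 1) • r + fun j => ((⌊(a • r) j⌋ - ⌊(b • r) j⌋ : ℤ) : ℝ) := by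
    ext j
    have h1 : (a • r) j - ⌊(a • r) j⌋ = (b • r) j - ⌊(b • r) j⌋ := congrFun heq j
    have h2 : ((b - a - 1 : ℕ) : ℝ) = b - a - 1 := by
      rw [Nat.sub_sub, Nat.cast_sub hab]
      push_cast
      ring
    simp only [Pi.add_apply, Pi.neg_apply, Pi.smul_apply, nsmul_eq_mul _ (r j), h2,
      Int.cast_sub] at h1 ⊢
    linarith
  have hm := (mem_S _).1 (nsmul_mem hr (b - a - 1))
  refine (mem_S _).2 ⟨neg_mem ((mem_S r).1 hr).1, ?_⟩
  rw [hz, fractVec_add_intCast]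
  exact hm.2

lemma exists_simplex_of_pos_dim {d k : ℕ} (hd : 1 ≤ d) {v : Fin (d + 1) → Fin d → ℤ}
    (hv : AffineIndependent ℝ (fun j => toReal (v j)))
    (hvanish : ∀ i : ℕ, k + 1 ≤ i → i ≤ 2 * k →
      Set.ncard {α | α ∈ Lambda v ∧ ht α = (i : ℝ)} = 0) :
    ∃ w : Fin (d + 1) → Fin d → ℤ, AffineIndependent ℝ (fun j => toReal (w j)) ∧
      ∀ n : ℕ, 1 ≤ n →
        latticeCount (convexHull ℝ (Set.range fun j => toReal (w j))) n =
          ∑ i ∈ Finset.range (k + 1),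
            Set.ncard {α | α ∈ Lambda v ∧ ht α = (i : ℝ)} * Nat.choose (n + d - i) d := by
  obtain ⟨L, hL⟩ := exists_addSubgroup_ht_le hv (k := k) fun α hα h2k => by
    obtain ⟨i, hi⟩ := exists_ht_eq_natCast hα
    by_contra! hlt
    rw [hi] at h2k hlt
    have := hvanish i (by exact_mod_cast hlt) (by exact_mod_cast h2k)
    rw [Set.ncard_eq_zero ((finite_Lambda hv).subset fun _ h => h.1)] at this
    exact this.subset ⟨hα, hi⟩
  obtain ⟨w, hw, hwL⟩ := exists_simplex_integralRelations_eq hv L (fun r hr => ((hL r).1 hr).1)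
    fun m => (hL _).2 ⟨intCast_mem_integralRelations v m, by simp [ht, fractVec]⟩
  have hΛ : ∀ α, α ∈ Lambda w ↔ α ∈ Lambda v ∧ ht α ≤ k := fun α => by
    rw [mem_Lambda_iff, mem_Lambda_iff, hwL, hL, and_assoc]
    refine and_congr_right fun h => ?_
    rw [fractVec_eq_self h]
  refine ⟨w, hw, fun n hn => ?_⟩
  rw [latticeCount_simplex_eq_sum hd hw (fun α hα => ((hΛ α).1 hα).2) hn]
  refine Finset.sum_congr rfl fun i hi => ?_
  congr 2
  ext α
  have hik : (i : ℝ) ≤ k := by exact_mod_cast Nat.le_of_lt_succ (Finset.mem_range.1 hi)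
  simp only [hΛ, Set.mem_ofPred_eq]
  exact ⟨fun h => ⟨h.1.1, h.2⟩, fun h => ⟨⟨h.1, h.2.trans_le hik⟩, h.2⟩⟩

lemma Lambda_fin_zero (v : Fin (0 + 1) → Fin 0 → ℤ) : Lambda v = {0} := by
  ext r
  constructor
  · rintro ⟨h0, -, z, hz⟩
    ext j
    obtain rfl : j = 0 := Fin.fin_one_eq_zero j
    rw [Fin.sum_univ_one] at hz
    have := Int.fract_eq_self.2 (h0 0)
    rw [hz, Int.fract_intCast] at this
    rw [hz, ← this, Pi.zero_apply]
  · rintro rfl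
    exact ⟨fun j => by simp, zero_mem (integralRelations v)⟩

lemma Lambda_unit_segment : Lambda (d := 1) ![0, 1] = {0} := by
  ext r
  constructor
  · rintro ⟨h0, h1, y, hy⟩
    obtain ⟨z, hz⟩ := h1 0
    replace hz : r 1 = z := by simpa [Fin.sum_univ_succ] using hz
    replace hy : r 0 + r 1 = y := by simpa [Fin.sum_univ_succ] using hy
    have e1 := Int.fract_eq_self.2 (h0 1)
    rw [hz, Int.fract_intCast] at e1
    have e0 := Int.fract_eq_self.2 (h0 0)
    rw [hz, ← e1, add_zero] at hy
    rw [hy, Int.fract_intCast] at e0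
    ext j
    fin_cases j
    · simp [hy, ← e0]
    · simp [hz, ← e1]
  · rintro rfl
    exact ⟨fun j => by simp, zero_mem (integralRelations _)⟩

lemma affineIndependent_unit_segment :
    AffineIndependent ℝ (fun j => toReal ((![0, 1] : Fin 2 → Fin 1 → ℤ) j)) := by
  refine affineIndependent_toReal_iff.2 fun c hc h => ?_
  have h1 : c 1 = 0 := by simpa [Fin.sum_univ_succ] using h 0
  replace hc : c 0 + c 1 = 0 := by simpa [Fin.sum_univ_succ] using hc
  rw [h1, add_zero] at hc
  ext j
  fin_cases j
  · exact hc
  · exact h1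

lemma ncard_singleton_zero_ht {m : ℕ} (i : ℕ) :
    Set.ncard {α : Fin m → ℝ | α ∈ ({0} : Set (Fin m → ℝ)) ∧ ht α = (i : ℝ)} =
      if i = 0 then 1 else 0 := by
  split_ifs with h
  · rw [Set.ncard_eq_one]
    refine ⟨0, Set.ext fun α => ⟨fun hα => hα.1, fun hα => ⟨hα, ?_⟩⟩⟩
    rw [Set.mem_singleton_iff.1 hα, h]
    simp [ht]
  · convert Set.ncard_empty (Fin m → ℝ)
    refine Set.eq_empty_of_forall_notMem fun α hα => h ?_
    have := hα.2
    rw [Set.mem_singleton_iff.1 hα.1] at this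
    simpa [ht, eq_comm] using this

/-- if `h_{k+1} = ⋯ = h_{2k} = 0` then `(h₀, …, h_k)` satisfies the
degree `k` condition: it is the h*-vector of some lattice simplex `Q ⊆ ℝ^e` of dimension `e`. -/
theorem stmt2 (d k : ℕ) (hk : 3 ≤ k) (v : Fin (d + 1) → Fin d → ℤ)
    (hv : AffineIndependent ℝ (fun j => toReal (v j)))
    (h : ℕ → ℕ)
    (hdef : ∀ i : ℕ, h i = Set.ncard {α | α ∈ Lambda v ∧ ht α = (i : ℝ)})
    (hvanish : ∀ i : ℕ, k + 1 ≤ i → i ≤ 2 * k → h i = 0) :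
    ∃ e : ℕ, 1 ≤ e ∧ ∃ w : Fin (e + 1) → Fin e → ℤ,
      AffineIndependent ℝ (fun j => toReal (w j)) ∧
      ∀ n : ℕ, 1 ≤ n →
        latticeCount (convexHull ℝ (Set.range fun j => toReal (w j))) n =
          ∑ i ∈ Finset.range (k + 1), h i * Nat.choose (n + e - i) e := by
  obtain rfl | hd := Nat.eq_zero_or_pos d
  · have hh : ∀ i, h i = Set.ncard {α | α ∈ Lambda (d := 1) ![0, 1] ∧ ht α = (i : ℝ)} :=
      fun i => by
        rw [hdef, Lambda_fin_zero, Lambda_unit_segment, ncard_singleton_zero_ht,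
          ncard_singleton_zero_ht]
    simp only [hh] at hvanish ⊢
    exact ⟨1, le_rfl, exists_simplex_of_pos_dim le_rfl affineIndependent_unit_segment hvanish⟩
  · simp only [hdef] at hvanish ⊢
    exact ⟨d, hd, exists_simplex_of_pos_dim hd hv hvanish⟩
end

section
/- Let Δ ⊂ ℝ^d be a lattice simplex of dimension d with vertices v_1, …, v_{d+1} ∈ ℤ^d and let k ≥ 3 be an integer. Assume that no α ∈ Λ_Δ satisfies k+1 ≤ ht(α) ≤ 2k. Then the set Λ' = { α ∈ Λ_Δ : ht(α) ≤ k } is a subgroup of Λ_Δ: it contains the zero vector, and it is closed under the addition (α + β)_i = {α_i + β_i} (fractional part of the coordinatewise sum) and under negation (−α)_i = {1 − α_i}. -/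
open scoped Pointwise

/-- The fractional part of a real vector satisfying the integrality conditions lies in `Λ_Δ`. -/
theorem fract_mem_Lambda {d : ℕ} {v : Fin (d + 1) → Fin d → ℤ} {r : Fin (d + 1) → ℝ}
    (hr : ∀ i : Fin d, ∃ z : ℤ, ∑ j, r j * (v j i : ℝ) = z) (hs : ∃ z : ℤ, ∑ j, r j = z) :
    (fun j => Int.fract (r j)) ∈ Lambda v := by
  refine ⟨fun j => ⟨Int.fract_nonneg _, Int.fract_lt_one _⟩, fun i => ?_, ?_⟩
  · obtain ⟨z, hz⟩ := hr i
    refine ⟨z - ∑ j, ⌊r j⌋ * v j i, ?_⟩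
    simp only [Int.fract, sub_mul, Finset.sum_sub_distrib, hz]
    push_cast
    rfl
  · obtain ⟨z, hz⟩ := hs
    refine ⟨z - ∑ j, ⌊r j⌋, ?_⟩
    simp only [Int.fract, Finset.sum_sub_distrib, hz]
    push_cast
    rfl

theorem fadd_mem_Lambda {d : ℕ} {v : Fin (d + 1) → Fin d → ℤ} {α β : Fin (d + 1) → ℝ}
    (hα : α ∈ Lambda v) (hβ : β ∈ Lambda v) : fadd α β ∈ Lambda v := by
  obtain ⟨-, hα, a, ha⟩ := hα
  obtain ⟨-, hβ, b, hb⟩ := hβ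
  refine fract_mem_Lambda (fun i => ?_) ⟨a + b, ?_⟩
  · obtain ⟨x, hx⟩ := hα i
    obtain ⟨y, hy⟩ := hβ i
    exact ⟨x + y, by simp only [add_mul, Finset.sum_add_distrib, hx, hy]; push_cast; rfl⟩
  · simp only [Finset.sum_add_distrib, ha, hb]
    push_cast
    rfl

theorem zero_mem_Lambda {d : ℕ} (v : Fin (d + 1) → Fin d → ℤ) :
    (0 : Fin (d + 1) → ℝ) ∈ Lambda v :=
  ⟨fun _ => by simp, fun _ => ⟨0, by simp⟩, 0, by simp⟩

theorem ht_fadd_le {m : ℕ} {α β : Fin m → ℝ} (hα : ∀ j, 0 ≤ α j) (hβ : ∀ j, 0 ≤ β j) :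
    ht (fadd α β) ≤ ht α + ht β := by
  unfold ht fadd
  rw [← Finset.sum_add_distrib]
  refine Finset.sum_le_sum fun j _ => ?_
  have : (0 : ℝ) ≤ ⌊α j + β j⌋ := by exact_mod_cast Int.floor_nonneg.2 (add_nonneg (hα j) (hβ j))
  rw [Int.fract]
  linarith

/-- The vertices of a simplex in homogeneous coordinates, as the columns of a matrix. -/
def homogeneousMatrix {d : ℕ} (v : Fin (d + 1) → Fin d → ℤ) :
    Matrix (Fin (d + 1)) (Fin (d + 1)) ℤ :=
  Matrix.of fun i j => (Fin.cons 1 (v j) : Fin (d + 1) → ℤ) i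

theorem det_homogeneousMatrix_ne_zero {d : ℕ} {v : Fin (d + 1) → Fin d → ℤ}
    (hv : AffineIndependent ℝ (fun j => toReal (v j))) : (homogeneousMatrix v).det ≠ 0 := by
  intro h
  have hdet : ((homogeneousMatrix v).map (Int.castRingHom ℝ)).det = 0 := by
    rw [← RingHom.mapMatrix_apply, ← RingHom.map_det, h, map_zero]
  obtain ⟨w, hw, hMw⟩ := Matrix.exists_mulVec_eq_zero_iff.2 hdet
  refine hw (funext fun j => affineIndependent_iff.1 hv Finset.univ w ?_ ?_ j (Finset.mem_univ j))
  · simpa [Matrix.mulVec, dotProduct, homogeneousMatrix] using congrFun hMw 0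
  · ext i
    simpa [Matrix.mulVec, dotProduct, homogeneousMatrix, toReal, mul_comm]
      using congrFun hMw i.succ

/-- Elements of `Λ_Δ` become integral after multiplication by the normalized volume of `Δ`. -/
theorem exists_int_eq_det_mul {d : ℕ} {v : Fin (d + 1) → Fin d → ℤ} {α : Fin (d + 1) → ℝ}
    (hα : α ∈ Lambda v) (j : Fin (d + 1)) :
    ∃ z : ℤ, ((homogeneousMatrix v).det : ℝ) * α j = z := by
  set M := (homogeneousMatrix v).map (Int.castRingHom ℝ) with hM
  have hz : ∀ i, ∃ z : ℤ, (M.mulVec α) i = z := by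
    intro i
    refine Fin.cases ?_ (fun i => ?_) i
    · simpa [M, Matrix.mulVec, dotProduct, homogeneousMatrix] using hα.2.2
    · simpa [M, Matrix.mulVec, dotProduct, homogeneousMatrix, mul_comm] using hα.2.1 i
  choose z hz using hz
  have hadj : M.adjugate = (homogeneousMatrix v).adjugate.map (Int.castRingHom ℝ) := by
    rw [hM, ← RingHom.mapMatrix_apply, ← RingHom.map_adjugate, RingHom.mapMatrix_apply]
  have hdet : M.det = ((homogeneousMatrix v).det : ℝ) := by
    rw [hM, ← RingHom.mapMatrix_apply, ← RingHom.map_det, eq_intCast]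
  have key : M.adjugate.mulVec (M.mulVec α) j = M.det * α j := by
    rw [Matrix.mulVec_mulVec, Matrix.adjugate_mul, Matrix.smul_mulVec, Matrix.one_mulVec,
      Pi.smul_apply, smul_eq_mul]
  refine ⟨((homogeneousMatrix v).adjugate.mulVec z) j, ?_⟩
  rw [← hdet, ← key, hadj, funext hz]
  simp [Matrix.mulVec, dotProduct]

theorem exists_pos_nat_mul_eq_int {d : ℕ} {v : Fin (d + 1) → Fin d → ℤ}
    (hv : AffineIndependent ℝ (fun j => toReal (v j))) {α : Fin (d + 1) → ℝ}
    (hα : α ∈ Lambda v) : ∃ n : ℕ, ∀ j, ∃ z : ℤ, ((n : ℝ) + 1) * α j = z := by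
  obtain ⟨n, hn⟩ := Nat.exists_eq_succ_of_ne_zero
    (Int.natAbs_ne_zero.2 (det_homogeneousMatrix_ne_zero hv))
  refine ⟨n, fun j => ?_⟩
  obtain ⟨z, hz⟩ := exists_int_eq_det_mul hα j
  rcases Int.natAbs_eq (homogeneousMatrix v).det with h | h <;> rw [h, hn] at hz <;>
    push_cast at hz
  · exact ⟨z, hz⟩
  · exact ⟨-z, by push_cast; linarith⟩

/-- A set of real vectors containing `0` and closed under `fadd` contains the negative of each of
its elements of finite order modulo `1`. -/
theorem fneg_mem_of_fadd_mem {m : ℕ} {S : Set (Fin m → ℝ)} (h0 : 0 ∈ S)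
    (hadd : ∀ α β, α ∈ S → β ∈ S → fadd α β ∈ S) {α : Fin m → ℝ} (hα : α ∈ S)
    {n : ℕ} (hn : ∀ j, ∃ z : ℤ, ((n : ℝ) + 1) * α j = z) : fneg α ∈ S := by
  have hmul : ∀ l : ℕ, (fun j => Int.fract ((l : ℝ) * α j)) ∈ S := by
    intro l
    induction l with
    | zero => simpa [← Pi.zero_def] using h0
    | succ l ih =>
      convert hadd _ _ ih hα using 1
      funext j
      refine Int.fract_eq_fract.2 ⟨⌊(l : ℝ) * α j⌋, ?_⟩
      push_cast
      linarith [Int.self_sub_fract ((l : ℝ) * α j)]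
  convert hmul n using 1
  funext j
  obtain ⟨z, hz⟩ := hn j
  refine Int.fract_eq_fract.2 ⟨1 - z, ?_⟩
  push_cast
  rw [← hz]
  ring

/-- `Λ' = {α ∈ Λ_Δ : ht(α) ≤ k}` is a subgroup of `Λ_Δ`: it contains the
zero vector and is closed under the fractional-part addition and negation. -/
theorem stmt4 (d k : ℕ) (hk : 3 ≤ k) (v : Fin (d + 1) → Fin d → ℤ)
    (hv : AffineIndependent ℝ (fun j => toReal (v j)))
    (hvanish : ∀ α ∈ Lambda v, ¬((k : ℝ) + 1 ≤ ht α ∧ ht α ≤ 2 * (k : ℝ))) :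
    ((0 : Fin (d + 1) → ℝ) ∈ {α | α ∈ Lambda v ∧ ht α ≤ (k : ℝ)}) ∧
    (∀ α β : Fin (d + 1) → ℝ, α ∈ {α | α ∈ Lambda v ∧ ht α ≤ (k : ℝ)} →
      β ∈ {α | α ∈ Lambda v ∧ ht α ≤ (k : ℝ)} →
      fadd α β ∈ {α | α ∈ Lambda v ∧ ht α ≤ (k : ℝ)}) ∧
    (∀ α ∈ {α | α ∈ Lambda v ∧ ht α ≤ (k : ℝ)},
      fneg α ∈ {α | α ∈ Lambda v ∧ ht α ≤ (k : ℝ)}) := by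
  have h0 : (0 : Fin (d + 1) → ℝ) ∈ {α | α ∈ Lambda v ∧ ht α ≤ (k : ℝ)} :=
    ⟨zero_mem_Lambda v, by simp [ht]⟩
  have hadd : ∀ α β : Fin (d + 1) → ℝ, α ∈ {α | α ∈ Lambda v ∧ ht α ≤ (k : ℝ)} →
      β ∈ {α | α ∈ Lambda v ∧ ht α ≤ (k : ℝ)} →
      fadd α β ∈ {α | α ∈ Lambda v ∧ ht α ≤ (k : ℝ)} := by
    rintro α β ⟨hα, hαk⟩ ⟨hβ, hβk⟩
    have hmem := fadd_mem_Lambda hα hβ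
    refine ⟨hmem, ?_⟩
    have hle := ht_fadd_le (fun j => (hα.1 j).1) (fun j => (hβ.1 j).1)
    obtain ⟨z, hz⟩ : ∃ z : ℤ, ht (fadd α β) = z := hmem.2.2
    by_contra! hlt
    refine hvanish _ hmem ⟨?_, by linarith⟩
    rw [hz] at hlt ⊢
    exact_mod_cast hlt
  refine ⟨h0, hadd, fun α hα => ?_⟩
  obtain ⟨n, hn⟩ := exists_pos_nat_mul_eq_int hv hα.1
  exact fneg_mem_of_fadd_mem h0 hadd hα hn
end
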